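/- Let 0 < c < 1, γ > 0, and 0 < q < 1. Let Φ be a solution of the ODE (B) on its maximal interval of existence I ⊆ (0,∞) with 1 ∈ I and Φ(1) = q. Then there exists a(q) ∈ (0,1) such that I = (a(q), ∞), Φ is strictly decreasing on I, Φ maps I onto (0,1) (in particular lim_{s→a(q)+} Φ(s) = 1 and lim_{s→∞} Φ(s) = 0). -/

import Mathlib

open Set Filter

noncomputable section

/-- The auxiliary first order ODE (B):
`Φ'(s) = − Φ(c²Φ² − 1)(1 + γ s² Φ²) / ( s (Φ − 1)(1 + c² γ s² Φ³) )`. -/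
def SolvesB (c γ : ℝ) (Φ : ℝ → ℝ) (I : Set ℝ) : Prop :=
  ∀ s ∈ I, HasDerivAt Φ
    (-(Φ s * (c ^ 2 * Φ s ^ 2 - 1) * (1 + γ * s ^ 2 * Φ s ^ 2)) /
      (s * (Φ s - 1) * (1 + c ^ 2 * γ * s ^ 2 * Φ s ^ 3))) s

/-- `Φ` is a solution of (B) on its maximal interval of existence `I ⊆ (0,∞)`:
`I` is an open subinterval of `(0,∞)` on which `Φ` solves (B), and no solution of (B)
on a larger open subinterval of `(0,∞)` agrees with `Φ` on `I`. -/
def IsMaximalBSolution (c γ : ℝ) (Φ : ℝ → ℝ) (I : Set ℝ) : Prop :=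
  IsOpen I ∧ I.OrdConnected ∧ I ⊆ Set.Ioi 0 ∧ SolvesB c γ Φ I ∧
    ∀ (Ψ : ℝ → ℝ) (J : Set ℝ), IsOpen J → J.OrdConnected → J ⊆ Set.Ioi 0 →
      SolvesB c γ Ψ J → I ⊆ J → Set.EqOn Ψ Φ I → J = I

/-- The right-hand side of the equation (B). -/
def fieldB (c γ s x : ℝ) : ℝ :=
  -(x * (c ^ 2 * x ^ 2 - 1) * (1 + γ * s ^ 2 * x ^ 2)) /
    (s * (x - 1) * (1 + c ^ 2 * γ * s ^ 2 * x ^ 3))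

lemma SolvesB.hasDerivAt {c γ : ℝ} {Φ : ℝ → ℝ} {I : Set ℝ} (h : SolvesB c γ Φ I) {s : ℝ}
    (hs : s ∈ I) : HasDerivAt Φ (fieldB c γ s (Φ s)) s :=
  h s hs

lemma SolvesB.mono {c γ : ℝ} {Φ : ℝ → ℝ} {I J : Set ℝ} (h : SolvesB c γ Φ I) (hJ : J ⊆ I) :
    SolvesB c γ Φ J :=
  fun s hs => h s (hJ hs)

lemma SolvesB.continuousOn {c γ : ℝ} {Φ : ℝ → ℝ} {I : Set ℝ} (h : SolvesB c γ Φ I) :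
    ContinuousOn Φ I :=
  fun _ hs => (h.hasDerivAt hs).continuousAt.continuousWithinAt

lemma mul_fieldB {c γ s x : ℝ} (hs : 0 < s) :
    s * fieldB c γ s x = -(x * ((1 - c ^ 2 * x ^ 2) * (1 + γ * s ^ 2 * x ^ 2) /
      ((1 - x) * (1 + c ^ 2 * γ * s ^ 2 * x ^ 3)))) := by
  have e : s * (x - 1) * (1 + c ^ 2 * γ * s ^ 2 * x ^ 3) =
      s * (-((1 - x) * (1 + c ^ 2 * γ * s ^ 2 * x ^ 3))) := by ring
  rw [fieldB, e, ← mul_div_assoc, mul_div_mul_left _ _ hs.ne', div_neg, ← mul_div_assoc]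
  congr 2
  ring

lemma mul_fieldB_le {c γ s x : ℝ} (hc0 : 0 < c) (hc1 : c < 1) (hγ : 0 < γ) (hs : 0 < s)
    (hx : x ∈ Ioo (0 : ℝ) 1) : s * fieldB c γ s x ≤ -x := by
  obtain ⟨hx0, hx1⟩ := hx
  rw [mul_fieldB hs]
  have hc2 : c ^ 2 ≤ 1 := by nlinarith
  have hG : 0 < γ * s ^ 2 * x ^ 2 := by positivity
  have hxx : c ^ 2 * x ≤ 1 := by nlinarith
  have h1 : 1 - x ≤ 1 - c ^ 2 * x ^ 2 := by nlinarith
  have h2 : 1 + c ^ 2 * γ * s ^ 2 * x ^ 3 ≤ 1 + γ * s ^ 2 * x ^ 2 := by nlinarith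
  have hd : 0 < (1 - x) * (1 + c ^ 2 * γ * s ^ 2 * x ^ 3) :=
    mul_pos (by linarith) (by positivity)
  have h3 : 1 ≤ (1 - c ^ 2 * x ^ 2) * (1 + γ * s ^ 2 * x ^ 2) /
      ((1 - x) * (1 + c ^ 2 * γ * s ^ 2 * x ^ 3)) := by
    rw [one_le_div hd]
    exact mul_le_mul h1 h2 (by positivity) (by linarith)
  nlinarith

lemma fieldB_neg {c γ s x : ℝ} (hc0 : 0 < c) (hc1 : c < 1) (hγ : 0 < γ) (hs : 0 < s)
    (hx : x ∈ Ioo (0 : ℝ) 1) : fieldB c γ s x < 0 := by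
  have := mul_fieldB_le hc0 hc1 hγ hs hx
  have := hx.1
  by_contra! h
  nlinarith [mul_nonneg hs.le h]

lemma neg_mul_le_mul_fieldB {c γ s x q : ℝ} (hc1 : c < 1) (hc0 : 0 < c) (hγ : 0 < γ)
    (hs : 0 < s) (hx : 0 < x) (hxq : x ≤ q) (hq : q < 1) (hsx : s * x ≤ q) :
    -((1 + γ * q ^ 2) / (1 - q) * x) ≤ s * fieldB c γ s x := by
  rw [mul_fieldB hs, neg_le_neg_iff, mul_comm x]
  refine mul_le_mul_of_nonneg_right ?_ hx.le
  have h0 : (s * x) ^ 2 ≤ q ^ 2 := pow_le_pow_left₀ (by positivity) hsx 2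
  have h1 : 1 + γ * s ^ 2 * x ^ 2 ≤ 1 + γ * q ^ 2 := by nlinarith
  have hG : 0 < c ^ 2 * γ * s ^ 2 * x ^ 3 := by positivity
  have h2 : 0 < c ^ 2 * x ^ 2 := by positivity
  refine div_le_div₀ (by positivity) ?_ (by linarith) ?_
  · have : 0 < γ * s ^ 2 * x ^ 2 := by positivity
    nlinarith
  · nlinarith

lemma contDiffAt_fieldB {c γ s x : ℝ} (hγ : 0 < γ) (hs : 0 < s) (hx : x ∈ Ioo (0 : ℝ) 1) :
    ContDiffAt ℝ 1 (fun p : ℝ × ℝ => fieldB c γ p.1 p.2) (s, x) := by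
  have hx0 := hx.1
  have hx1 : x - 1 ≠ 0 := by linarith [hx.2]
  have : s * (x - 1) * (1 + c ^ 2 * γ * s ^ 2 * x ^ 3) ≠ 0 := by
    have : 0 < 1 + c ^ 2 * γ * s ^ 2 * x ^ 3 := by positivity
    positivity
  unfold fieldB
  refine ContDiffAt.div (by fun_prop) (by fun_prop) this

lemma exists_local_solvesB {c γ s x : ℝ} (hγ : 0 < γ) (hs : 0 < s) (hx : x ∈ Ioo (0 : ℝ) 1) :
    ∃ ψ : ℝ → ℝ, ψ s = x ∧ ∃ ε > 0, SolvesB c γ ψ (Ioo (s - ε) (s + ε)) := by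
  have hf : ContDiffAt ℝ 1 (fun p : ℝ × ℝ => ((1 : ℝ), fieldB c γ p.1 p.2)) (s, x) :=
    contDiffAt_const.prodMk (contDiffAt_fieldB hγ hs hx)
  obtain ⟨α, hα, ε, hε, h⟩ :=
    hf.exists_forall_mem_closedBall_exists_eq_forall_mem_Ioo_hasDerivAt₀ s
  have hs' : s ∈ Ioo (s - ε) (s + ε) := ⟨by linarith, by linarith⟩
  have hd : ∀ t ∈ Ioo (s - ε) (s + ε), HasDerivAt (fun t => (α t).1) 1 t := fun t ht =>
    (hasFDerivAt_fst (𝕜 := ℝ) (p := α t)).comp_hasDerivAt t (h t ht)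
  have h1 : EqOn (fun t => (α t).1) id (Ioo (s - ε) (s + ε)) :=
    isOpen_Ioo.eqOn_of_deriv_eq isPreconnected_Ioo
      (fun t ht => (hd t ht).differentiableAt.differentiableWithinAt)
      differentiableOn_id (fun t ht => by rw [(hd t ht).deriv, deriv_id]) hs' (by simp [hα])
  refine ⟨fun t => (α t).2, by simp [hα], ε, hε, fun t ht => ?_⟩
  have h2 : HasDerivAt (fun t => (α t).2) (fieldB c γ (α t).1 (α t).2) t :=
    (hasFDerivAt_snd (𝕜 := ℝ) (p := α t)).comp_hasDerivAt t (h t ht)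
  rw [show (α t).1 = t from h1 ht] at h2
  exact h2

/-- Two solutions of (B) with a common limit at `b` glue to a solution across `b`. -/
lemma SolvesB.glue {c γ x y b L : ℝ} {Φ ψ : ℝ → ℝ} (hγ : 0 < γ) (hb : 0 < b) (hxb : x < b)
    (hby : b < y) (hL : L ∈ Ioo (0 : ℝ) 1) (hΦ : SolvesB c γ Φ (Ioo x b))
    (hψ : SolvesB c γ ψ (Ioo b y)) (hΦL : Tendsto Φ (nhdsWithin b (Iio b)) (nhds L))
    (hψL : Tendsto ψ (nhdsWithin b (Ioi b)) (nhds L)) :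
    SolvesB c γ (fun s => if s < b then Φ s else if s = b then L else ψ s) (Ioo x y) := by
  set Ψ : ℝ → ℝ := fun s => if s < b then Φ s else if s = b then L else ψ s with hΨ
  have eL : EqOn Ψ Φ (Iio b) := fun s hs => if_pos hs
  have eR : EqOn Ψ ψ (Ioi b) := fun s (hs : b < s) => by simp [hΨ, hs.not_gt, hs.ne']
  have eb : Ψ b = L := by simp [hΨ]
  have dL : ∀ s ∈ Ioo x b, HasDerivAt Ψ (fieldB c γ s (Ψ s)) s := fun s hs => by
    rw [eL hs.2]
    exact (hΦ.hasDerivAt hs).congr_of_eventuallyEq (eL.eventuallyEq_of_mem (Iio_mem_nhds hs.2))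
  have dR : ∀ s ∈ Ioo b y, HasDerivAt Ψ (fieldB c γ s (Ψ s)) s := fun s hs => by
    rw [eR hs.1]
    exact (hψ.hasDerivAt hs).congr_of_eventuallyEq (eR.eventuallyEq_of_mem (Ioi_mem_nhds hs.1))
  have tL : Tendsto Ψ (nhdsWithin b (Iio b)) (nhds L) :=
    hΦL.congr' (eL.symm.eventuallyEq_of_mem self_mem_nhdsWithin)
  have tR : Tendsto Ψ (nhdsWithin b (Ioi b)) (nhds L) :=
    hψL.congr' (eR.symm.eventuallyEq_of_mem self_mem_nhdsWithin)
  have mL : Ioo x b ∈ nhdsWithin b (Iio b) := Ioo_mem_nhdsLT hxb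
  have mR : Ioo b y ∈ nhdsWithin b (Ioi b) := Ioo_mem_nhdsGT hby
  have hlim : ∀ S : Set ℝ, Tendsto Ψ (nhdsWithin b S) (nhds L) →
      Tendsto (fun s => fieldB c γ s (Ψ s)) (nhdsWithin b S) (nhds (fieldB c γ b L)) := by
    intro S hS
    exact (contDiffAt_fieldB hγ hb hL).continuousAt.tendsto.comp
      ((tendsto_id.mono_left nhdsWithin_le_nhds).prodMk_nhds hS)
  intro s hs
  rcases lt_trichotomy s b with h | rfl | h
  · exact dL s ⟨hs.1, h⟩
  · have hl : HasDerivWithinAt Ψ (fieldB c γ s L) (Iic s) s := by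
      refine hasDerivWithinAt_Iic_of_tendsto_deriv (s := Ioo x s)
        (fun t ht => (dL t ht).differentiableAt.differentiableWithinAt) ?_ mL ?_
      · rw [ContinuousWithinAt, eb]
        exact tL.mono_left (nhdsWithin_mono _ Ioo_subset_Iio_self)
      · refine (hlim _ tL).congr' ?_
        filter_upwards [mL] with t ht using (dL t ht).deriv.symm
    have hr : HasDerivWithinAt Ψ (fieldB c γ s L) (Ici s) s := by
      refine hasDerivWithinAt_Ici_of_tendsto_deriv (s := Ioo s y)
        (fun t ht => (dR t ht).differentiableAt.differentiableWithinAt) ?_ mR ?_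
      · rw [ContinuousWithinAt, eb]
        exact tR.mono_left (nhdsWithin_mono _ Ioo_subset_Ioi_self)
      · refine (hlim _ tR).congr' ?_
        filter_upwards [mR] with t ht using (dR t ht).deriv.symm
    have hu := hl.union hr
    rw [Iic_union_Ici, hasDerivWithinAt_univ, ← eb] at hu
    exact hu
  · exact dR s ⟨h, hs.2⟩

lemma IsMaximalBSolution.Ioo_subset {c γ x y : ℝ} {Φ Ψ : ℝ → ℝ} {I : Set ℝ}
    (hmax : IsMaximalBSolution c γ Φ I) (hx : 0 ≤ x) (hΨ : SolvesB c γ Ψ (Ioo x y))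
    (heq : EqOn Ψ Φ (I ∩ Ioo x y)) (hne : (I ∩ Ioo x y).Nonempty) : Ioo x y ⊆ I := by
  classical
  obtain ⟨hI, hIc, hI0, hΦ, hm⟩ := hmax
  have eI : EqOn (I.piecewise Φ Ψ) Φ I := I.piecewise_eqOn Φ Ψ
  have eΨ : EqOn (I.piecewise Φ Ψ) Ψ (Ioo x y) := fun s hs => by
    by_cases h : s ∈ I
    · rw [I.piecewise_eq_of_mem _ _ h, heq ⟨h, hs⟩]
    · exact I.piecewise_eq_of_notMem _ _ h
  have hJ : (I ∪ Ioo x y).OrdConnected := by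
    obtain ⟨z, hz1, hz2⟩ := hne
    exact (hIc.isPreconnected.union z hz1 hz2 isPreconnected_Ioo).ordConnected
  have := hm (I.piecewise Φ Ψ) (I ∪ Ioo x y) (hI.union isOpen_Ioo) hJ
    (union_subset hI0 fun s hs => hx.trans_lt hs.1) ?_ subset_union_left eI
  · exact union_eq_left.1 this
  · rintro s (hs | hs)
    · have := (hΦ.hasDerivAt hs).congr_of_eventuallyEq (eI.eventuallyEq_of_mem (hI.mem_nhds hs))
      rw [← eI hs] at this
      exact this
    · have := (hΨ.hasDerivAt hs).congr_of_eventuallyEq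
        (eΨ.eventuallyEq_of_mem (isOpen_Ioo.mem_nhds hs))
      rw [← eΨ hs] at this
      exact this

lemma IsMaximalBSolution.mem_of_tendsto_left {c γ x b L : ℝ} {Φ : ℝ → ℝ} {I : Set ℝ}
    (hmax : IsMaximalBSolution c γ Φ I) (hγ : 0 < γ) (hx : 0 ≤ x) (hxb : x < b)
    (hI : I ⊆ Iic b) (hxI : Ioo x b ⊆ I) (hL : L ∈ Ioo (0 : ℝ) 1)
    (hΦL : Tendsto Φ (nhdsWithin b (Iio b)) (nhds L)) : b ∈ I := by
  by_contra hb
  obtain ⟨ψ, hψb, ε, hε, hψ⟩ := exists_local_solvesB (c := c) hγ (hx.trans_lt hxb) hL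
  have hbm : b ∈ Ioo (b - ε) (b + ε) := ⟨by linarith, by linarith⟩
  have hψL : Tendsto ψ (nhdsWithin b (Ioi b)) (nhds L) := by
    rw [← hψb]
    exact (hψ.hasDerivAt hbm).continuousAt.tendsto.mono_left nhdsWithin_le_nhds
  have hg := SolvesB.glue hγ (hx.trans_lt hxb) hxb hbm.2 hL (hmax.2.2.2.1.mono hxI)
    (hψ.mono (Ioo_subset_Ioo_left hbm.1.le)) hΦL hψL
  refine hb (hmax.Ioo_subset hx hg ?_ ?_ ⟨hxb, hbm.2⟩)
  · intro s hs
    have : s < b := (hI hs.1).lt_of_ne fun h => hb (h ▸ hs.1)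
    simp [this]
  · obtain ⟨z, hz⟩ := exists_between hxb
    exact ⟨z, hxI hz, hz.1, hz.2.trans hbm.2⟩

lemma IsMaximalBSolution.mem_of_tendsto_right {c γ y b L : ℝ} {Φ : ℝ → ℝ} {I : Set ℝ}
    (hmax : IsMaximalBSolution c γ Φ I) (hγ : 0 < γ) (hb0 : 0 < b) (hby : b < y)
    (hI : I ⊆ Ici b) (hyI : Ioo b y ⊆ I) (hL : L ∈ Ioo (0 : ℝ) 1)
    (hΦL : Tendsto Φ (nhdsWithin b (Ioi b)) (nhds L)) : b ∈ I := by
  by_contra hb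
  obtain ⟨ψ, hψb, ε, hε, hψ⟩ := exists_local_solvesB (c := c) hγ hb0 hL
  have hbm : b ∈ Ioo (b - ε) (b + ε) := ⟨by linarith, by linarith⟩
  have hψL : Tendsto ψ (nhdsWithin b (Iio b)) (nhds L) := by
    rw [← hψb]
    exact (hψ.hasDerivAt hbm).continuousAt.tendsto.mono_left nhdsWithin_le_nhds
  have hm : max 0 (b - ε) < b := max_lt hb0 hbm.1
  have hg := SolvesB.glue hγ hb0 hm hby hL
    (hψ.mono (Ioo_subset_Ioo (le_max_right _ _) hbm.2.le)) (hmax.2.2.2.1.mono hyI) hψL hΦL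
  refine hb (hmax.Ioo_subset (le_max_left _ _) hg ?_ ?_ ⟨hm, hby⟩)
  · intro s hs
    have : b < s := (hI hs.1).lt_of_ne fun h => hb (h ▸ hs.1)
    simp [this.not_gt, this.ne']
  · obtain ⟨z, hz⟩ := exists_between hby
    exact ⟨z, hyI hz, hm.trans hz.1, hz.2⟩

lemma SolvesB.antitoneOn_mul {c γ a b : ℝ} {Φ : ℝ → ℝ} (hc0 : 0 < c) (hc1 : c < 1) (hγ : 0 < γ)
    (ha : 0 < a) (h : SolvesB c γ Φ (Icc a b)) (hΦ : ∀ s ∈ Ioo a b, Φ s ∈ Ioo (0 : ℝ) 1) :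
    AntitoneOn (fun s => s * Φ s) (Icc a b) := by
  refine antitoneOn_of_hasDerivWithinAt_nonpos (convex_Icc a b)
    (f' := fun s => 1 * Φ s + s * fieldB c γ s (Φ s)) (continuousOn_id.mul h.continuousOn) ?_ ?_
  · intro s hs
    exact ((hasDerivAt_id s).mul (h.hasDerivAt (interior_subset hs))).hasDerivWithinAt
  · intro s hs
    rw [interior_Icc] at hs
    have := mul_fieldB_le hc0 hc1 hγ (ha.trans hs.1) (hΦ s hs)
    linarith

lemma SolvesB.monotoneOn_rpow_mul {c γ q b : ℝ} {Φ : ℝ → ℝ} (hc0 : 0 < c) (hc1 : c < 1)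
    (hγ : 0 < γ) (hq1 : q < 1) (h : SolvesB c γ Φ (Icc 1 b)) (hΦ1 : Φ 1 = q)
    (hΦ : ∀ s ∈ Ioo 1 b, Φ s ∈ Ioo (0 : ℝ) 1) :
    MonotoneOn (fun s => s ^ ((1 + γ * q ^ 2) / (1 - q)) * Φ s) (Icc 1 b) := by
  set M := (1 + γ * q ^ 2) / (1 - q) with hM
  refine monotoneOn_of_hasDerivWithinAt_nonneg (convex_Icc 1 b)
    (f' := fun s => M * s ^ (M - 1) * Φ s + s ^ M * fieldB c γ s (Φ s)) ?_ ?_ ?_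
  · refine ContinuousOn.mul (fun s hs => ?_) h.continuousOn
    exact (Real.continuousAt_rpow_const _ _
      (Or.inl (zero_lt_one.trans_le hs.1).ne')).continuousWithinAt
  · intro s hs
    have hs' := interior_subset hs
    exact ((Real.hasDerivAt_rpow_const (Or.inl (zero_lt_one.trans_le hs'.1).ne')).mul
      (h.hasDerivAt hs')).hasDerivWithinAt
  · intro s hs
    rw [interior_Icc] at hs
    have hs0 : 0 < s := zero_lt_one.trans hs.1
    have hx := hΦ s hs
    have hsx : s * Φ s ≤ q := by
      have := h.antitoneOn_mul hc0 hc1 hγ one_pos hΦ (left_mem_Icc.2 (hs.1.trans hs.2).le)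
        (Ioo_subset_Icc_self hs) hs.1.le
      simpa [hΦ1] using this
    have hxq : Φ s ≤ q := by nlinarith [hx.1, hs.1]
    have hb := neg_mul_le_mul_fieldB hc1 hc0 hγ hs0 hx.1 hxq hq1 hsx
    rw [← hM] at hb
    have e : M * s ^ (M - 1) * Φ s + s ^ M * fieldB c γ s (Φ s) =
        s ^ (M - 1) * (M * Φ s + s * fieldB c γ s (Φ s)) := by
      have : s ^ M = s ^ (M - 1) * s := by
        rw [← Real.rpow_add_one hs0.ne', sub_add_cancel]
      rw [this]; ring
    rw [e]
    exact mul_nonneg (Real.rpow_nonneg hs0.le _) (by linarith)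

lemma SolvesB.le_of_one_le {c γ q s : ℝ} {Φ : ℝ → ℝ} (hc0 : 0 < c) (hc1 : c < 1)
    (hγ : 0 < γ) (hq1 : q < 1) (hs : 1 ≤ s) (h : SolvesB c γ Φ (Icc 1 s)) (hΦ1 : Φ 1 = q)
    (hΦ : ∀ t ∈ Ioo 1 s, Φ t ∈ Ioo (0 : ℝ) 1) :
    s * Φ s ≤ q ∧ q ≤ s ^ ((1 + γ * q ^ 2) / (1 - q)) * Φ s := by
  constructor
  · simpa [hΦ1] using h.antitoneOn_mul hc0 hc1 hγ one_pos hΦ (left_mem_Icc.2 hs)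
      (right_mem_Icc.2 hs) hs
  · simpa [hΦ1] using h.monotoneOn_rpow_mul hc0 hc1 hγ hq1 hΦ1 hΦ (left_mem_Icc.2 hs)
      (right_mem_Icc.2 hs) hs

lemma SolvesB.le_mul_of_le_one {c γ q s : ℝ} {Φ : ℝ → ℝ} (hc0 : 0 < c) (hc1 : c < 1)
    (hγ : 0 < γ) (hs0 : 0 < s) (hs : s ≤ 1) (h : SolvesB c γ Φ (Icc s 1)) (hΦ1 : Φ 1 = q)
    (hΦ : ∀ t ∈ Ioo s 1, Φ t ∈ Ioo (0 : ℝ) 1) : q ≤ s * Φ s := by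
  simpa [hΦ1] using h.antitoneOn_mul hc0 hc1 hγ hs0 hΦ (left_mem_Icc.2 hs)
      (right_mem_Icc.2 hs) hs

/-- A solution of (B) with values in `(0, 1)` to the right of `t` does not take the value `1` at
`t`: there the right-hand side is `0`, while `s * Φ s` is nonincreasing. -/
lemma SolvesB.ne_one {c γ t b : ℝ} {Φ : ℝ → ℝ} (hc0 : 0 < c) (hc1 : c < 1) (hγ : 0 < γ)
    (ht0 : 0 < t) (htb : t < b) (h : SolvesB c γ Φ (Icc t b))
    (hΦ : ∀ s ∈ Ioo t b, Φ s ∈ Ioo (0 : ℝ) 1) : Φ t ≠ 1 := by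
  intro ht
  have hm := h.antitoneOn_mul hc0 hc1 hγ ht0 hΦ
  have hd := (hasDerivAt_id t).mul (h.hasDerivAt (left_mem_Icc.2 htb.le))
  have hz : fieldB c γ t (Φ t) = 0 := by simp [fieldB, ht]
  have hw := hd.hasDerivWithinAt (s := Icc t b)
  have := hw.nonpos_of_antitoneOn (uniqueDiffOn_Icc htb t (left_mem_Icc.2 htb.le)).accPt hm
  rw [hz, ht] at this
  norm_num at this

lemma SolvesB.mem_Ioo {c γ q : ℝ} {Φ : ℝ → ℝ} {I : Set ℝ} (hc0 : 0 < c) (hc1 : c < 1)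
    (hγ : 0 < γ) (hq0 : 0 < q) (hq1 : q < 1) (hIc : I.OrdConnected) (hI0 : I ⊆ Ioi 0)
    (h : SolvesB c γ Φ I) (h1 : (1 : ℝ) ∈ I) (hΦ1 : Φ 1 = q) {s : ℝ} (hs : s ∈ I) :
    Φ s ∈ Ioo (0 : ℝ) 1 := by
  by_contra hbad
  have hclosed : ∀ x y, Icc x y ⊆ I → IsCompact (Icc x y ∩ Φ ⁻¹' (Ioo 0 1)ᶜ) := fun x y hxy =>
    isCompact_Icc.of_isClosed_subset ((h.mono hxy).continuousOn.preimage_isClosed_of_isClosed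
      isClosed_Icc isOpen_Ioo.isClosed_compl) inter_subset_left
  rcases le_total 1 s with h1s | hs1
  · have hsub : Icc 1 s ⊆ I := hIc.out h1 hs
    obtain ⟨t, ⟨ht, htbad⟩, hleast⟩ := (hclosed 1 s hsub).exists_isLeast ⟨s, ⟨h1s, le_rfl⟩, hbad⟩
    have hgood : ∀ r ∈ Ioo 1 t, Φ r ∈ Ioo (0 : ℝ) 1 := fun r hr => by
      by_contra hr'
      exact hr.2.not_ge (hleast ⟨⟨hr.1.le, hr.2.le.trans ht.2⟩, hr'⟩)
    obtain ⟨hu, hl⟩ := (h.mono ((Icc_subset_Icc_right ht.2).trans hsub)).le_of_one_le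
      hc0 hc1 hγ hq1 ht.1 hΦ1 hgood
    have ht1 : 1 ≤ t := ht.1
    have hpos : 0 < Φ t := pos_of_mul_pos_right (hq0.trans_le hl)
      (Real.rpow_nonneg (zero_le_one.trans ht1) _)
    exact htbad ⟨hpos, by nlinarith⟩
  · have hsub : Icc s 1 ⊆ I := hIc.out hs h1
    obtain ⟨t, ⟨ht, htbad⟩, hgreatest⟩ :=
      (hclosed s 1 hsub).exists_isGreatest ⟨s, ⟨le_rfl, hs1⟩, hbad⟩
    have hgood : ∀ r ∈ Ioo t 1, Φ r ∈ Ioo (0 : ℝ) 1 := fun r hr => by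
      by_contra hr'
      exact hr.1.not_ge (hgreatest ⟨⟨ht.1.trans hr.1.le, hr.2.le⟩, hr'⟩)
    have ht0 : 0 < t := hI0 (hsub ht)
    have ht1 : t < 1 := ht.2.lt_of_ne fun e => htbad (by rw [e, hΦ1]; exact ⟨hq0, hq1⟩)
    have hsol := h.mono ((Icc_subset_Icc_left ht.1).trans hsub)
    have hl := hsol.le_mul_of_le_one hc0 hc1 hγ ht0 ht1.le hΦ1 hgood
    have hpos : 0 < Φ t := pos_of_mul_pos_right (hq0.trans_le hl) ht0.le
    have hle : Φ t ≤ 1 := by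
      refine le_of_tendsto ((h.hasDerivAt (hsub ht)).continuousAt.tendsto.mono_left
        (nhdsWithin_le_nhds (s := Ioi t))) ?_
      filter_upwards [Ioo_mem_nhdsGT ht1] with r hr using (hgood r hr).2.le
    exact htbad ⟨hpos, hle.lt_of_ne (hsol.ne_one hc0 hc1 hγ ht0 ht1 hgood)⟩

lemma IsOpen.sSup_notMem {I : Set ℝ} (hI : IsOpen I) (hb : BddAbove I) : sSup I ∉ I := by
  intro h
  obtain ⟨u, hu, hsub⟩ := exists_Ico_subset_of_mem_nhds (hI.mem_nhds h) (exists_gt _)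
  obtain ⟨z, hz⟩ := exists_between hu
  exact hz.1.not_ge (le_csSup hb (hsub ⟨hz.1.le, hz.2⟩))

lemma IsOpen.sInf_notMem {I : Set ℝ} (hI : IsOpen I) (hb : BddBelow I) : sInf I ∉ I := by
  intro h
  obtain ⟨u, hu, hsub⟩ := exists_Ioc_subset_of_mem_nhds (hI.mem_nhds h) (exists_lt _)
  obtain ⟨z, hz⟩ := exists_between hu
  exact hz.2.not_ge (csInf_le hb (hsub ⟨hz.1, hz.2.le⟩))

/-- For `0 < c < 1`, `γ > 0`, `0 < q < 1`, a maximal solution `Φ` of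
(B) with `Φ(1) = q` has maximal interval `(a(q), ∞)` for some `a(q) ∈ (0,1)`, is
strictly decreasing, maps its interval onto `(0,1)`, tends to `1` as `s → a(q)+` and to
`0` as `s → ∞`. -/
theorem stmt11 (c γ q : ℝ) (hc0 : 0 < c) (hc1 : c < 1) (hγ : 0 < γ)
    (hq0 : 0 < q) (hq1 : q < 1)
    (Φ : ℝ → ℝ) (I : Set ℝ) (hmax : IsMaximalBSolution c γ Φ I)
    (h1 : (1 : ℝ) ∈ I) (hΦ1 : Φ 1 = q) :
    ∃ aq : ℝ, 0 < aq ∧ aq < 1 ∧ I = Set.Ioi aq ∧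
      StrictAntiOn Φ I ∧ Φ '' I = Set.Ioo 0 1 ∧
      Filter.Tendsto Φ (nhdsWithin aq (Set.Ioi aq)) (nhds 1) ∧
      Filter.Tendsto Φ Filter.atTop (nhds 0) := by
  obtain ⟨hI, hIc, hI0, hΦ, -⟩ := id hmax
  have hval : ∀ s ∈ I, Φ s ∈ Ioo (0 : ℝ) 1 := fun s hs =>
    hΦ.mem_Ioo hc0 hc1 hγ hq0 hq1 hIc hI0 h1 hΦ1 hs
  have hanti : StrictAntiOn Φ I :=
    strictAntiOn_of_hasDerivWithinAt_neg hIc.convex hΦ.continuousOn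
      (fun s hs => (hΦ.hasDerivAt (interior_subset hs)).hasDerivWithinAt)
      fun s hs => fieldB_neg hc0 hc1 hγ (hI0 (interior_subset hs)) (hval s (interior_subset hs))
  have hright : ∀ s ∈ I, 1 ≤ s →
      s * Φ s ≤ q ∧ q ≤ s ^ ((1 + γ * q ^ 2) / (1 - q)) * Φ s := fun s hs h1s =>
    (hΦ.mono (hIc.out h1 hs)).le_of_one_le hc0 hc1 hγ hq1 h1s hΦ1
      fun t ht => hval t (hIc.out h1 hs (Ioo_subset_Icc_self ht))
  have hqI : ∀ s ∈ I, q < s := fun s hs => by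
    rcases le_or_gt s 1 with hs1 | hs1
    · have hs0 : 0 < s := hI0 hs
      have := (hΦ.mono (hIc.out hs h1)).le_mul_of_le_one hc0 hc1 hγ hs0 hs1 hΦ1
        fun t ht => hval t (hIc.out hs h1 (Ioo_subset_Icc_self ht))
      nlinarith [(hval s hs).2]
    · exact hq1.trans hs1
  have hbelow : BddBelow I := ⟨q, fun s hs => (hqI s hs).le⟩
  have hne : I.Nonempty := ⟨1, h1⟩
  have habove : ¬ BddAbove I := by
    intro hab
    have hb := hI.sSup_notMem hab
    have h1b : 1 < sSup I := (le_csSup hab h1).lt_of_ne fun e => hb (e ▸ h1)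
    have hsub : Ioo 1 (sSup I) ⊆ I := fun s hs => by
      obtain ⟨z, hz, hsz⟩ := exists_lt_of_lt_csSup hne hs.2
      exact hIc.out h1 hz ⟨hs.1.le, hsz.le⟩
    have hlim := AntitoneOn.tendsto_nhdsWithin_Ioo_left (nonempty_Ioo.2 h1b)
      (hanti.antitoneOn.mono hsub)
      ⟨0, by rintro _ ⟨s, hs, rfl⟩; exact (hval s (hsub hs)).1.le⟩
    refine hb (hmax.mem_of_tendsto_left hγ zero_le_one h1b (fun s hs => le_csSup hab hs) hsub
      ⟨?_, ?_⟩ hlim)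
    · have hB : 0 < sSup I ^ ((1 + γ * q ^ 2) / (1 - q)) :=
        Real.rpow_pos_of_pos (one_pos.trans h1b) _
      refine (div_pos hq0 hB).trans_le (le_csInf ((nonempty_Ioo.2 h1b).image Φ) ?_)
      rintro _ ⟨s, hs, rfl⟩
      rw [div_le_iff₀' hB]
      refine (hright s (hsub hs) hs.1.le).2.trans
        (mul_le_mul_of_nonneg_right ?_ (hval s (hsub hs)).1.le)
      exact Real.rpow_le_rpow (zero_le_one.trans hs.1.le) hs.2.le
        (div_nonneg (by positivity) (by linarith))
    · obtain ⟨z, hz⟩ := nonempty_Ioo.2 h1b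
      exact (csInf_le ⟨0, by rintro _ ⟨s, hs, rfl⟩; exact (hval s (hsub hs)).1.le⟩
        (mem_image_of_mem Φ hz)).trans_lt (hval z (hsub hz)).2
  have ha := hI.sInf_notMem hbelow
  have hqa : q ≤ sInf I := le_csInf hne fun s hs => (hqI s hs).le
  have ha1 : sInf I < 1 := (csInf_le hbelow h1).lt_of_ne fun e => ha (e.symm ▸ h1)
  have hIeq : I = Ioi (sInf I) :=
    Subset.antisymm (fun s hs => (csInf_le hbelow hs).lt_of_ne fun e => ha (e.symm ▸ hs))
      (hIc.isPreconnected.Ioi_csInf_subset hbelow habove)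
  have hsub : Ioo (sInf I) 1 ⊆ I := fun s hs => hIeq ▸ hs.1
  have hbdd : BddAbove (Φ '' Ioo (sInf I) 1) :=
    ⟨1, by rintro _ ⟨s, hs, rfl⟩; exact (hval s (hsub hs)).2.le⟩
  have hlim := AntitoneOn.tendsto_nhdsWithin_Ioo_right (nonempty_Ioo.2 ha1)
    (hanti.antitoneOn.mono hsub) hbdd
  have hL : sSup (Φ '' Ioo (sInf I) 1) = 1 := by
    refine (csSup_le ((nonempty_Ioo.2 ha1).image Φ) ?_).eq_of_not_lt fun hlt => ?_
    · rintro _ ⟨s, hs, rfl⟩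
      exact (hval s (hsub hs)).2.le
    · obtain ⟨z, hz⟩ := nonempty_Ioo.2 ha1
      exact ha (hmax.mem_of_tendsto_right hγ (hq0.trans_le hqa) ha1
        (fun s hs => csInf_le hbelow hs) hsub
        ⟨(hval z (hsub hz)).1.trans_le (le_csSup hbdd (mem_image_of_mem Φ hz)), hlt⟩ hlim)
  rw [hL] at hlim
  have hmem : ∀ s : ℝ, 1 ≤ s → s ∈ I := fun s hs => hIeq ▸ ha1.trans_le hs
  have htop : Tendsto Φ atTop (nhds 0) := by
    refine squeeze_zero' (g := fun s => q / s) ?_ ?_ (tendsto_const_nhds.div_atTop tendsto_id)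
    · filter_upwards [eventually_ge_atTop 1] with s hs using (hval s (hmem s hs)).1.le
    · filter_upwards [eventually_ge_atTop 1] with s hs
      rw [le_div_iff₀' (one_pos.trans_le hs)]
      exact (hright s (hmem s hs) hs).1
  refine ⟨sInf I, hq0.trans_le hqa, ha1, hIeq, hanti, ?_, hlim, htop⟩
  refine Subset.antisymm (by rintro _ ⟨s, hs, rfl⟩; exact hval s hs) ?_
  refine hIc.isPreconnected.intermediate_value_Ioo (l₁ := atTop)
    (l₂ := nhdsWithin (sInf I) (Ioi (sInf I))) ?_ ?_ hΦ.continuousOn htop hlim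
  · exact le_principal_iff.2 (mem_of_superset (Ici_mem_atTop 1) hmem)
  · exact le_principal_iff.2 (mem_of_superset self_mem_nhdsWithin hIeq.symm.subset)

end
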